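/- arXiv:2602.05580 — 7 statements merged into one kernel-verified Lean document; each statement's English description precedes it below -/
import Mathlib

section
/- Let Λ be an N×N real symmetric matrix with eigendecomposition Λ = Q Ω Qᵀ, where Q is orthogonal and Ω = diag(ω₁,…,ω_N). Let Ω₊ = diag(max(ω₁,0),…,max(ω_N,0)). Then Q Ω₊ Qᵀ is the projection of Λ onto the cone of N×N real symmetric positive semidefinite matrices with respect to the Frobenius norm: for every symmetric positive semidefinite N×N matrix Y, ‖Λ − Q Ω₊ Qᵀ‖_F ≤ ‖Λ − Y‖_F, and Q Ω₊ Qᵀ is itself symmetric positive semidefinite. -/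
open Matrix BigOperators

/-- Frobenius norm of a real square matrix. -/
noncomputable def frobNorm {N : ℕ} (A : Matrix (Fin N) (Fin N) ℝ) : ℝ :=
  Real.sqrt (∑ i, ∑ j, (A i j) ^ 2)

theorem frob_inv {N : ℕ} (Q A : Matrix (Fin N) (Fin N) ℝ) (hQ : Qᵀ * Q = 1) :
    frobNorm (Q * A * Qᵀ) = frobNorm A := by
  have key : ∀ B : Matrix (Fin N) (Fin N) ℝ, ∑ i, ∑ j, (B i j) ^ 2 = (B * Bᵀ).trace := by
    intro B
    simp [Matrix.trace, Matrix.mul_apply, pow_two]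
  unfold frobNorm
  rw [key, key]
  congr 1
  have : (Q * A * Qᵀ) * (Q * A * Qᵀ)ᵀ = Q * (A * (Qᵀ * Q) * Aᵀ * Qᵀ) := by
    simp only [Matrix.transpose_mul, Matrix.transpose_transpose, Matrix.mul_assoc]
  rw [this, hQ, Matrix.trace_mul_comm, Matrix.mul_assoc _ Qᵀ Q, hQ, Matrix.mul_one, Matrix.mul_one]

/-- Projection onto the PSD cone via truncating negative eigenvalues. -/
theorem psd_projection_eig_truncation
    {N : ℕ} (Λ Q : Matrix (Fin N) (Fin N) ℝ) (ω : Fin N → ℝ)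
    (hΛ : Λ.IsSymm)
    (hQ : Qᵀ * Q = 1) (hQ' : Q * Qᵀ = 1)
    (hdec : Λ = Q * Matrix.diagonal ω * Qᵀ) :
    (Q * Matrix.diagonal (fun i => max (ω i) 0) * Qᵀ).PosSemidef ∧
    ∀ Y : Matrix (Fin N) (Fin N) ℝ, Y.PosSemidef →
      frobNorm (Λ - Q * Matrix.diagonal (fun i => max (ω i) 0) * Qᵀ) ≤ frobNorm (Λ - Y) := by
  constructor
  · have h : (Matrix.diagonal (fun i => max (ω i) 0)).PosSemidef :=
      Matrix.PosSemidef.diagonal (fun i => le_max_right _ _)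
    simpa using h.mul_mul_conjTranspose_same Q
  · intro Y hY
    have hZ : (Qᵀ * Y * Q).PosSemidef := by
      simpa using hY.conjTranspose_mul_mul_same Q
    have hYZ : Y = Q * (Qᵀ * Y * Q) * Qᵀ := by
      have : Q * (Qᵀ * Y * Q) * Qᵀ = (Q * Qᵀ) * Y * (Q * Qᵀ) := by
        simp only [Matrix.mul_assoc]
      rw [this, hQ', Matrix.one_mul, Matrix.mul_one]
    generalize Qᵀ * Y * Q = Z at hZ hYZ
    rw [hdec, hYZ, ← Matrix.sub_mul, ← Matrix.mul_sub, ← Matrix.sub_mul, ← Matrix.mul_sub,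
      frob_inv _ _ hQ, frob_inv _ _ hQ]
    unfold frobNorm
    refine Real.sqrt_le_sqrt (Finset.sum_le_sum fun i _ => Finset.sum_le_sum fun j _ => ?_)
    by_cases hij : i = j
    · subst hij
      have hz : 0 ≤ Z i i := hZ.diag_nonneg
      simp only [Matrix.sub_apply, Matrix.diagonal_apply_eq]
      rcases le_total (ω i) 0 with h | h
      · rw [max_eq_right h]; nlinarith
      · rw [max_eq_left h]; nlinarith [sq_nonneg (ω i - Z i i)]
    · simp only [Matrix.sub_apply, Matrix.diagonal_apply_ne _ hij]
      nlinarith [sq_nonneg (Z i j)]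
end

section
/- Let Σ be an N×N real symmetric positive definite matrix whose inverse Λ = Σ⁻¹ has all off-diagonal entries nonpositive (i.e. Λ is a symmetric M-matrix). Then for all indices i ≠ j, the magnitude of the partial correlation does not exceed the correlation: |Λ_{ij}|/√(Λ_{ii}·Λ_{jj}) ≤ Σ_{ij}/√(Σ_{ii}·Σ_{jj}). -/
open Matrix

theorem aux_nonneg {N : ℕ} (L : Matrix (Fin N) (Fin N) ℝ) (hL : L.PosDef)
    (hM : ∀ i j, i ≠ j → L i j ≤ 0) (x : Fin N → ℝ)
    (hx : ∀ k, x k < 0 → 0 ≤ (L *ᵥ x) k) : ∀ k, 0 ≤ x k := by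
  set y : Fin N → ℝ := fun k => max (-x k) 0 with hy
  set z : Fin N → ℝ := fun k => max (x k) 0 with hz
  have hyn : ∀ k, 0 ≤ y k := fun k => le_max_right _ _
  have hzn : ∀ k, 0 ≤ z k := fun k => le_max_right _ _
  have hxzy : x = z - y := by
    funext k
    simp only [hy, hz, Pi.sub_apply]
    rcases le_total (x k) 0 with h | h
    · rw [max_eq_right h, max_eq_left (by linarith)]; ring
    · rw [max_eq_left h, max_eq_right (by linarith)]; ring
  have hyz : ∀ k, y k * z k = 0 := by
    intro k
    simp only [hy, hz]
    rcases le_total (x k) 0 with h | h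
    · rw [max_eq_right h, mul_zero]
    · rw [max_eq_right (a := -x k) (by linarith), zero_mul]
  have h1 : 0 ≤ y ⬝ᵥ (L *ᵥ x) := by
    refine Finset.sum_nonneg fun k _ => ?_
    by_cases h : x k < 0
    · exact mul_nonneg (hyn k) (hx k h)
    · have : y k = 0 := max_eq_right (by linarith)
      rw [this, zero_mul]
  have h2 : y ⬝ᵥ (L *ᵥ z) ≤ 0 := by
    refine Finset.sum_nonpos fun k _ => ?_
    simp only [mulVec, dotProduct, Finset.mul_sum]
    refine Finset.sum_nonpos fun l _ => ?_
    by_cases h : k = l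
    · subst h
      have := hyz k
      apply le_of_eq
      linear_combination L k k * this
    · have := mul_nonneg (hyn k) (hzn l)
      nlinarith [hM k l h]
  have h3 : y = 0 := by
    by_contra h
    have := hL.dotProduct_mulVec_pos h
    rw [hxzy, mulVec_sub, dotProduct_sub] at h1
    simp only [star_trivial] at this
    linarith
  intro k
  have := congrFun h3 k
  have h4 := le_max_left (-x k) 0
  simp only [hy, Pi.zero_apply] at this
  linarith

theorem aux_main {N : ℕ} (S L : Matrix (Fin N) (Fin N) ℝ) (hS : S.PosDef) (hL : L.PosDef)
    (hLS : L * S = 1)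
    (hM : ∀ i j, i ≠ j → L i j ≤ 0) (i j : Fin N) (hij : i ≠ j) :
    0 < S i i * S j j - S i j ^ 2 ∧
    S j j ≤ L i i * (S i i * S j j - S i j ^ 2) ∧
    - S i j ≤ L j i * (S i i * S j j - S i j ^ 2) := by
  have hsym : S j i = S i j := by simpa using hS.isHermitian.apply i j
  set w : Fin N → ℝ := Pi.single i (S j j) - Pi.single j (S i j) with hw
  set x := S *ᵥ w with hx
  have hxk : ∀ k, x k = S k i * S j j - S k j * S i j := by
    intro k
    simp [hx, hw, mulVec_sub]
    ring
  have hwi : w i = S j j := by simp [hw, hij]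
  have hwj : w j = - S i j := by simp [hw, hij.symm]
  have hwk : ∀ k, k ≠ i → k ≠ j → w k = 0 := by
    intro k h1 h2; simp [hw, h1, h2]
  have hjj : 0 < S j j := hS.diag_pos
  have hLx : L *ᵥ x = w := by rw [hx, mulVec_mulVec, hLS, one_mulVec]
  have hxi : x i = S i i * S j j - S i j ^ 2 := by rw [hxk]; ring
  have hxj : x j = 0 := by rw [hxk, hsym]; ring
  have hD : 0 < x i := by
    have hw0 : w ≠ 0 := by
      intro h
      rw [h] at hwi
      simp at hwi
      linarith
    have := hS.dotProduct_mulVec_pos hw0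
    rw [star_trivial, ← hx] at this
    have e : w ⬝ᵥ x = S j j * x i := by
      rw [hw, sub_dotProduct, single_dotProduct, single_dotProduct, hxj]; ring
    rw [e] at this
    exact (pos_iff_pos_of_mul_pos this).1 hjj
  have hxn : ∀ k, 0 ≤ x k := by
    apply aux_nonneg L hL hM
    intro k hk
    rw [hLx]
    have h1 : k ≠ i := by rintro rfl; linarith
    have h2 : k ≠ j := by rintro rfl; linarith
    exact (hwk k h1 h2).ge
  have key : ∀ p, (p = i ∨ p = j) → w p ≤ L p i * x i := by
    intro p hp
    rw [← hLx]
    simp only [mulVec, dotProduct]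
    rw [← Finset.add_sum_erase _ _ (Finset.mem_univ i)]
    have : ∑ k ∈ Finset.univ.erase i, L p k * x k ≤ 0 := by
      refine Finset.sum_nonpos fun k hk => ?_
      have hki := Finset.ne_of_mem_erase hk
      by_cases hkj : k = j
      · rw [hkj, hxj, mul_zero]
      · refine mul_nonpos_of_nonpos_of_nonneg (hM p k ?_) (hxn k)
        rcases hp with rfl | rfl
        · exact hki.symm
        · exact Ne.symm hkj
    linarith
  rw [← hxi]
  refine ⟨hD, ?_, ?_⟩
  · rw [← hwi]; exact key i (Or.inl rfl)
  · rw [← hwj]; exact key j (Or.inr rfl)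

/-- For a positive definite covariance matrix whose precision matrix is a symmetric
M-matrix, the magnitude of every partial correlation does not exceed the
corresponding correlation. -/
theorem abs_partial_correlation_le_correlation
    {N : ℕ} (S : Matrix (Fin N) (Fin N) ℝ)
    (hS : S.PosDef)
    (Λ : Matrix (Fin N) (Fin N) ℝ)
    (hΛ : Λ = S⁻¹)
    (hM : ∀ i j, i ≠ j → Λ i j ≤ 0) :
    ∀ i j, i ≠ j →
      |Λ i j| / Real.sqrt (Λ i i * Λ j j) ≤ S i j / Real.sqrt (S i i * S j j) := by
  intro i j hij
  have hL : Λ.PosDef := hΛ ▸ hS.inv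
  have hLS : Λ * S = 1 := by
    rw [hΛ]
    exact nonsing_inv_mul _ ((isUnit_iff_isUnit_det _).1 hS.isUnit)
  have hsym : S j i = S i j := by simpa using hS.isHermitian.apply i j
  obtain ⟨hD, h1, -⟩ := aux_main S Λ hS hL hLS hM i j hij
  obtain ⟨-, h2, h3⟩ := aux_main S Λ hS hL hLS hM j i hij.symm
  rw [hsym, mul_comm (S j j)] at h2 h3
  set D := S i i * S j j - S i j ^ 2
  have hii : 0 < S i i := hS.diag_pos
  have hjj : 0 < S j j := hS.diag_pos
  have lii : 0 < Λ i i := hL.diag_pos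
  have ljj : 0 < Λ j j := hL.diag_pos
  rw [abs_of_nonpos (hM i j hij)]
  have hs : Real.sqrt (S i i * S j j) ≤ D * Real.sqrt (Λ i i * Λ j j) := by
    rw [← Real.sqrt_sq hD.le, ← Real.sqrt_mul (sq_nonneg D)]
    apply Real.sqrt_le_sqrt
    have := mul_le_mul h1 h2 hii.le (by positivity)
    nlinarith
  have p1 : 0 < Real.sqrt (S i i * S j j) := by positivity
  have p2 : 0 < Real.sqrt (Λ i i * Λ j j) := by positivity
  rw [div_le_div_iff₀ p2 p1]
  have hn : 0 ≤ - Λ i j := by linarith [hM i j hij]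
  calc - Λ i j * Real.sqrt (S i i * S j j) ≤ - Λ i j * (D * Real.sqrt (Λ i i * Λ j j)) :=
        mul_le_mul_of_nonneg_left hs hn
    _ = (- Λ i j * D) * Real.sqrt (Λ i i * Λ j j) := by ring
    _ ≤ _ := mul_le_mul_of_nonneg_right (by linarith) p2.le
end

section
/- Let Σ be an N×N symmetric inverse M-matrix, i.e. a real symmetric positive definite matrix whose inverse Σ⁻¹ is a symmetric M-matrix, and let S ⊆ {1,…,N} be a nonempty index set. Then the principal submatrix of Σ with rows and columns indexed by S is itself a symmetric inverse M-matrix, i.e. it is positive definite and its inverse has nonpositive off-diagonal entries. -/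
open Matrix

/-- Every (nonempty) principal submatrix of a symmetric inverse M-matrix is itself a
symmetric inverse M-matrix. -/
theorem principal_submatrix_inverse_m_matrix
    {N : ℕ} (A : Matrix (Fin N) (Fin N) ℝ)
    (hA : A.PosDef)
    (hInvM : ∀ i j, i ≠ j → A⁻¹ i j ≤ 0)
    (S : Finset (Fin N)) (hS : S.Nonempty) :
    (A.submatrix (fun i : {x // x ∈ S} => (i : Fin N)) (fun j : {x // x ∈ S} => (j : Fin N))).PosDef ∧
    (∀ i j : {x // x ∈ S}, i ≠ j →
      (A.submatrix (fun i : {x // x ∈ S} => (i : Fin N)) (fun j : {x // x ∈ S} => (j : Fin N)))⁻¹ i j ≤ 0) := by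
  have hB : (A.submatrix (fun i : {x // x ∈ S} => (i : Fin N))
      (fun j : {x // x ∈ S} => (j : Fin N))).PosDef := hA.submatrix Subtype.val_injective
  refine ⟨hB, ?_⟩
  intro i j hij
  set B := A.submatrix (fun i : {x // x ∈ S} => (i : Fin N))
      (fun j : {x // x ∈ S} => (j : Fin N)) with hBdef
  have hBu : B * B⁻¹ = 1 := Matrix.mul_nonsing_inv _ ((Matrix.isUnit_iff_isUnit_det _).1 hB.isUnit)
  have hAu : A⁻¹ * A = 1 := Matrix.nonsing_inv_mul _ ((Matrix.isUnit_iff_isUnit_det _).1 hA.isUnit)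
  let v : Fin N → ℝ := fun k => if h : k ∈ S then B⁻¹ ⟨k, h⟩ j else 0
  let w : Fin N → ℝ := A *ᵥ v
  have hKw : A⁻¹ *ᵥ w = v := by
    simp only [w, Matrix.mulVec_mulVec, hAu, Matrix.one_mulVec]
  have hvi : v i = B⁻¹ i j := by simp [v]
  have hv0 : ∀ k, k ∉ S → v k = 0 := fun k hk => by simp [v, hk]
  have hwS : ∀ k : {x // x ∈ S}, w k = (1 : Matrix {x // x ∈ S} {x // x ∈ S} ℝ) k j := by
    intro k
    rw [← hBu, Matrix.mul_apply]
    simp only [w, Matrix.mulVec, dotProduct]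
    rw [← Finset.sum_subset (Finset.subset_univ S)
      (fun x _ hx => by rw [hv0 x hx, mul_zero]), ← Finset.sum_coe_sort S]
    refine Finset.sum_congr rfl fun x _ => ?_
    simp [v, hBdef]
  have hwS0 : ∀ k ∈ S, 0 ≤ w k := by
    intro k hk
    rw [hwS ⟨k, hk⟩, Matrix.one_apply]
    split_ifs <;> norm_num
  let n : Fin N → ℝ := fun k => max (-w k) 0
  let p : Fin N → ℝ := fun k => max (w k) 0
  have hn : ∀ k, 0 ≤ n k := fun k => le_max_right _ _
  have hp : ∀ k, 0 ≤ p k := fun k => le_max_right _ _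
  have hnp : ∀ k, n k * p k = 0 := by
    intro k
    rcases le_total 0 (w k) with h | h
    · simp [n, h]
    · simp [p, h]
  have hwpn : w = p - n := by
    ext k
    rcases le_total 0 (w k) with h | h
    · simp [n, p, h]
    · simp [n, p, h]
  have h0 : n ⬝ᵥ (A⁻¹ *ᵥ w) = 0 := by
    rw [hKw]
    refine Finset.sum_eq_zero fun k _ => ?_
    by_cases hk : k ∈ S
    · have := hwS0 k hk
      simp [n, this]
    · rw [hv0 k hk, mul_zero]
  have h1 : n ⬝ᵥ (A⁻¹ *ᵥ p) ≤ 0 := by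
    simp only [dotProduct, Matrix.mulVec, Finset.mul_sum]
    refine Finset.sum_nonpos fun a _ => Finset.sum_nonpos fun b _ => ?_
    by_cases hab : a = b
    · subst hab
      have := hnp a
      apply le_of_eq
      linear_combination (A⁻¹ a a) * this
    · exact mul_nonpos_of_nonneg_of_nonpos (hn a)
        (mul_nonpos_of_nonpos_of_nonneg (hInvM a b hab) (hp b))
  have hn0 : n = 0 := by
    by_contra hne
    have h2 := hA.inv.dotProduct_mulVec_pos hne
    rw [hwpn, Matrix.mulVec_sub, dotProduct_sub] at h0
    simp only [star_trivial] at h2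
    linarith
  have hw0 : ∀ k, 0 ≤ w k := by
    intro k
    rw [hwpn, hn0]
    simpa using hp k
  rw [← hvi, ← hKw]
  simp only [Matrix.mulVec, dotProduct]
  refine Finset.sum_nonpos fun k _ => ?_
  by_cases hk : (i : Fin N) = k
  · subst hk
    rw [hwS i, Matrix.one_apply_ne hij, mul_zero]
  · exact mul_nonpos_of_nonpos_of_nonneg (hInvM _ _ hk) (hw0 k)
end

section
/- Let Σ and Γ be N×N symmetric inverse M-matrices (real symmetric positive definite matrices whose inverses are symmetric M-matrices) such that Γ⁻¹ ≤ Σ⁻¹ entrywise, i.e. (Γ⁻¹)_{ij} ≤ (Σ⁻¹)_{ij} for all i, j. Then C(Σ) ≤ C(Γ) entrywise, where C(A) denotes the correlation normalization of A, C(A)_{ij} = A_{ij}/√(A_{ii}·A_{jj}). -/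
open Matrix

lemma mmat_nonneg {N : ℕ} (A : Matrix (Fin N) (Fin N) ℝ) (hA : A.PosDef)
    (hM : ∀ i j, i ≠ j → A i j ≤ 0) (x : Fin N → ℝ)
    (hx : ∀ i, x i < 0 → 0 ≤ (A *ᵥ x) i) : ∀ i, 0 ≤ x i := by
  by_contra! hc
  obtain ⟨k, hk⟩ := hc
  set m : Fin N → ℝ := fun i => max (-x i) 0 with hm
  have hm0 : m ≠ 0 := by
    intro h
    have := congrFun h k
    simp only [hm, Pi.zero_apply] at this
    have := le_max_left (-x k) 0
    linarith
  have h1 := hA.dotProduct_mulVec_pos hm0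
  have h2 : 0 ≤ m ⬝ᵥ (A *ᵥ x) := by
    apply Finset.sum_nonneg
    intro i _
    by_cases h : x i < 0
    · exact mul_nonneg (le_max_right _ _) (hx i h)
    · have : m i = 0 := max_eq_right (by linarith)
      simp [this]
  have h3 : m ⬝ᵥ (A *ᵥ m) + m ⬝ᵥ (A *ᵥ x) ≤ 0 := by
    rw [← dotProduct_add, ← mulVec_add]
    simp only [dotProduct, mulVec, Finset.mul_sum]
    apply Finset.sum_nonpos
    intro i _
    apply Finset.sum_nonpos
    intro j _
    have a1 : 0 ≤ m i := le_max_right _ _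
    have a2 : 0 ≤ (m + x) j := by
      have := le_max_left (-x j) 0
      simp only [Pi.add_apply, hm]; linarith
    by_cases hij : i = j
    · subst hij
      have : m i * (m + x) i = 0 := by
        simp only [Pi.add_apply, hm]
        rcases le_total (-x i) 0 with h | h
        · simp [max_eq_right h]
        · simp [max_eq_left h]
      have e : m i * (A i i * (m + x) i) = A i i * (m i * (m + x) i) := by ring
      rw [e, this, mul_zero]
    · exact mul_nonpos_of_nonneg_of_nonpos a1
        (mul_nonpos_of_nonpos_of_nonneg (hM i j hij) a2)
  simp only [star_trivial] at h1
  linarith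

lemma inv_mulVec_col {N : ℕ} (S : Matrix (Fin N) (Fin N) ℝ) (hS : S.PosDef) (i j : Fin N) :
    (S⁻¹ *ᵥ (fun k => S k j)) i = if i = j then 1 else 0 := by
  have h : S⁻¹ * S = 1 := Matrix.nonsing_inv_mul S ((Matrix.isUnit_iff_isUnit_det _).1 hS.isUnit)
  have := congrFun (congrFun h i) j
  rw [Matrix.one_apply] at this
  rw [← this]; rfl

lemma inv_nonneg_entries {N : ℕ} (S : Matrix (Fin N) (Fin N) ℝ) (hS : S.PosDef)
    (hSM : ∀ i j, i ≠ j → S⁻¹ i j ≤ 0) (i j : Fin N) : 0 ≤ S i j := by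
  refine mmat_nonneg S⁻¹ hS.inv hSM (fun k => S k j) (fun l _ => ?_) i
  rw [inv_mulVec_col S hS]
  split_ifs <;> norm_num

lemma ratio_le {N : ℕ} (S G : Matrix (Fin N) (Fin N) ℝ)
    (hS : S.PosDef) (hG : G.PosDef)
    (hSM : ∀ i j, i ≠ j → S⁻¹ i j ≤ 0)
    (hGM : ∀ i j, i ≠ j → G⁻¹ i j ≤ 0)
    (hle : ∀ i j, G⁻¹ i j ≤ S⁻¹ i j) (i j : Fin N) :
    S i j / S j j ≤ G i j / G j j := by
  have hs : 0 < S j j := hS.diag_pos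
  have hg : 0 < G j j := hG.diag_pos
  have key := mmat_nonneg G⁻¹ hG.inv hGM
    ((G j j)⁻¹ • (fun k => G k j) - (S j j)⁻¹ • (fun k => S k j)) ?_ i
  · simp only [Pi.sub_apply, Pi.smul_apply, smul_eq_mul] at key
    rw [div_eq_inv_mul, div_eq_inv_mul]
    linarith
  · intro l hl
    have hlj : l ≠ j := by
      rintro rfl
      simp [hs.ne', hg.ne'] at hl
    rw [mulVec_sub, mulVec_smul, mulVec_smul]
    simp only [Pi.sub_apply, Pi.smul_apply, smul_eq_mul]
    rw [inv_mulVec_col G hG, if_neg hlj]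
    have h0 := inv_mulVec_col S hS l j
    rw [if_neg hlj] at h0
    have h1 : (G⁻¹ *ᵥ (fun k => S k j)) l ≤ (S⁻¹ *ᵥ (fun k => S k j)) l := by
      simp only [mulVec, dotProduct]
      exact Finset.sum_le_sum fun k _ =>
        mul_le_mul_of_nonneg_right (hle l k) (inv_nonneg_entries S hS hSM k j)
    rw [h0] at h1
    have := mul_nonpos_of_nonneg_of_nonpos (inv_nonneg.2 hs.le) h1
    linarith

lemma corr_eq (a s t : ℝ) (ha : 0 ≤ a) :
    a / Real.sqrt (s * t) = Real.sqrt ((a / s) * (a / t)) := by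
  rw [div_mul_div_comm, Real.sqrt_div (by positivity), Real.sqrt_mul_self ha]

/-- If two symmetric inverse M-matrices have entrywise-comparable inverses,
their correlation normalizations compare entrywise in the reverse direction. -/
theorem correlation_normalization_antitone
    {N : ℕ} (S G : Matrix (Fin N) (Fin N) ℝ)
    (hS : S.PosDef) (hG : G.PosDef)
    (hSM : ∀ i j, i ≠ j → S⁻¹ i j ≤ 0)
    (hGM : ∀ i j, i ≠ j → G⁻¹ i j ≤ 0)
    (hle : ∀ i j, G⁻¹ i j ≤ S⁻¹ i j) :
    ∀ i j, S i j / Real.sqrt (S i i * S j j) ≤ G i j / Real.sqrt (G i i * G j j) := by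
  intro i j
  have nS := inv_nonneg_entries S hS hSM
  have nG := inv_nonneg_entries G hG hGM
  have r1 := ratio_le S G hS hG hSM hGM hle i j
  have r2 := ratio_le S G hS hG hSM hGM hle j i
  have sS : S j i = S i j := by simpa using hS.isHermitian.apply i j
  have sG : G j i = G i j := by simpa using hG.isHermitian.apply i j
  rw [sS, sG] at r2
  rw [corr_eq _ _ _ (nS i j), corr_eq _ _ _ (nG i j)]
  apply Real.sqrt_le_sqrt
  exact mul_le_mul r2 r1 (div_nonneg (nS i j) (nS j j)) (div_nonneg (nG i j) (nG i i))
end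

section
/- Let Σ be an (m+n)×(m+n) symmetric inverse M-matrix (a real symmetric positive definite matrix whose inverse is a symmetric M-matrix), written in block form Σ = [[Σ₁₁, Σ₁₂],[Σ₂₁, Σ₂₂]] with Σ₁₁ of size m×m. Then (Σ₁₁ − Σ₁₂ Σ₂₂⁻¹ Σ₂₁)⁻¹ ≥ Σ₁₁⁻¹ entrywise, i.e. every entry of the inverse of the Schur complement is greater than or equal to the corresponding entry of Σ₁₁⁻¹. -/
open Matrix

lemma aux_inv_nonneg {n : ℕ} (S : Matrix (Fin n) (Fin n) ℝ) (hS : S.PosDef)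
    (hM : ∀ i j, i ≠ j → S i j ≤ 0) (k j : Fin n) : 0 ≤ S⁻¹ k j := by
  have hu : IsUnit S.det := (Matrix.isUnit_iff_isUnit_det S).1 hS.isUnit
  have hSS : S * S⁻¹ = 1 := Matrix.mul_nonsing_inv S hu
  set x : Fin n → ℝ := fun i => S⁻¹ i j with hx
  set y : Fin n → ℝ := fun i => max (-x i) 0 with hy
  have hSx : ∀ i, 0 ≤ ∑ l, S i l * x l := by
    intro i
    have := congrFun (congrFun hSS i) j
    rw [Matrix.mul_apply] at this
    simp only [hx]
    rw [this, Matrix.one_apply]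
    split_ifs <;> norm_num
  have hy0 : ∀ i, 0 ≤ y i := fun i => le_max_right _ _
  have hle : ∑ i, y i * ∑ l, S i l * y l ≤ 0 := by
    have h1 : ∑ i, y i * ∑ l, S i l * (x l + y l) ≤ 0 := by
      apply Finset.sum_nonpos
      intro i _
      rw [Finset.mul_sum]
      apply Finset.sum_nonpos
      intro l _
      have hxl : 0 ≤ x l + y l := by
        have : -x l ≤ y l := le_max_left _ _
        linarith
      by_cases h : i = l
      · subst h
        have : y i * (x i + y i) = 0 := by
          simp only [hy]
          rcases max_cases (-x i) 0 with h | h <;> rw [h.1] <;> ring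
        have h2 : y i * (S i i * (x i + y i)) = S i i * (y i * (x i + y i)) := by ring
        rw [h2, this, mul_zero]
      · exact mul_nonpos_of_nonneg_of_nonpos (hy0 i)
          (mul_nonpos_of_nonpos_of_nonneg (hM i l h) hxl)
    have h2 : 0 ≤ ∑ i, y i * ∑ l, S i l * x l :=
      Finset.sum_nonneg fun i _ => mul_nonneg (hy0 i) (hSx i)
    simp only [mul_add, Finset.sum_add_distrib] at h1
    linarith
  have hyz : y = 0 := by
    by_contra hne
    have := hS.dotProduct_mulVec_pos hne
    simp only [dotProduct, mulVec, star_trivial] at this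
    linarith
  have h3 : -x k ≤ y k := le_max_left _ _
  rw [hyz] at h3
  simpa using h3

/-- For a symmetric inverse M-matrix in block form, the inverse of the Schur
complement dominates the inverse of the top-left block entrywise. -/
theorem inv_schur_complement_ge_inv_block
    {m n : ℕ}
    (A : Matrix (Fin m) (Fin m) ℝ) (B : Matrix (Fin m) (Fin n) ℝ)
    (C : Matrix (Fin n) (Fin m) ℝ) (D : Matrix (Fin n) (Fin n) ℝ)
    (hpd : (Matrix.fromBlocks A B C D).PosDef)
    (hM : ∀ i j, i ≠ j → (Matrix.fromBlocks A B C D)⁻¹ i j ≤ 0) :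
    ∀ i j : Fin m, A⁻¹ i j ≤ (A - B * D⁻¹ * C)⁻¹ i j := by
  have hu := (Matrix.isUnit_iff_isUnit_det _).1 hpd.isUnit
  have hK := hpd.inv
  have hmul := Matrix.mul_nonsing_inv _ hu
  generalize (Matrix.fromBlocks A B C D)⁻¹ = K at hM hK hmul
  obtain ⟨P, Q, R, S, rfl⟩ : ∃ P Q R S, K = Matrix.fromBlocks P Q R S :=
    ⟨_, _, _, _, (Matrix.fromBlocks_toBlocks K).symm⟩
  rw [Matrix.fromBlocks_multiply, ← Matrix.fromBlocks_one, Matrix.fromBlocks_inj] at hmul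
  obtain ⟨h1, h2, h3, h4⟩ := hmul
  have hD : D.PosDef := hpd.submatrix (e := Sum.inr) Sum.inr_injective
  have hS : S.PosDef := hK.submatrix (e := Sum.inr) Sum.inr_injective
  have hDu := (Matrix.isUnit_iff_isUnit_det _).1 hD.isUnit
  have hSu := (Matrix.isUnit_iff_isUnit_det _).1 hS.isUnit
  have e1 : (A - B * D⁻¹ * C)⁻¹ = P := by
    apply Matrix.inv_eq_right_inv
    have : C * P = -(D * R) := eq_neg_of_add_eq_zero_left h3
    rw [Matrix.sub_mul, Matrix.mul_assoc, this, Matrix.mul_neg, Matrix.mul_assoc,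
      Matrix.nonsing_inv_mul_cancel_left _ _ hDu, sub_neg_eq_add, h1]
  have e2 : A⁻¹ = P - Q * S⁻¹ * R := by
    apply Matrix.inv_eq_right_inv
    have : A * Q = -(B * S) := eq_neg_of_add_eq_zero_left h2
    rw [Matrix.mul_sub, ← Matrix.mul_assoc, ← Matrix.mul_assoc, this, Matrix.neg_mul,
      Matrix.mul_nonsing_inv_cancel_right _ _ hSu, Matrix.neg_mul, sub_neg_eq_add, h1]
  have hSn := aux_inv_nonneg S hS (fun i j hij => by
    simpa using hM (Sum.inr i) (Sum.inr j) (by simpa using hij))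
  have hQ : ∀ i j, Q i j ≤ 0 := fun i j => by simpa using hM (Sum.inl i) (Sum.inr j) (by simp)
  have hR : ∀ i j, R i j ≤ 0 := fun i j => by simpa using hM (Sum.inr i) (Sum.inl j) (by simp)
  intro i j
  rw [e1, e2, Matrix.sub_apply]
  have : 0 ≤ (Q * S⁻¹ * R) i j := by
    rw [Matrix.mul_apply]
    apply Finset.sum_nonneg
    intro l _
    apply mul_nonneg_of_nonpos_of_nonpos _ (hR l j)
    rw [Matrix.mul_apply]
    exact Finset.sum_nonpos fun k _ => mul_nonpos_of_nonpos_of_nonneg (hQ i k) (hSn k l)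
  linarith
end

section
/- Let Γ be an (N+1)×(N+1) symmetric inverse M-matrix (a real symmetric positive definite matrix whose inverse is a symmetric M-matrix), partitioned as Γ = [[γ, γᵥᵀ],[γᵥ, Γ']], where γ is a scalar, γᵥ ∈ ℝ^N, and Γ' is N×N. Then (Γ')⁻¹ γᵥ ≥ 0 entrywise, i.e. every component of the vector (Γ')⁻¹ γᵥ is nonnegative. -/
open Matrix

/-- For a symmetric inverse M-matrix `Γ = [[γ, γᵥᵀ],[γᵥ, Γ']]`, the vector
`(Γ')⁻¹ γᵥ` is entrywise nonnegative. -/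
theorem inv_block_mulvec_nonneg
    {N : ℕ} (γ : ℝ) (γv : Fin N → ℝ) (Γ' : Matrix (Fin N) (Fin N) ℝ)
    (Γ : Matrix (Unit ⊕ Fin N) (Unit ⊕ Fin N) ℝ)
    (hΓ : Γ = Matrix.fromBlocks (Matrix.of fun _ _ => γ)
              (Matrix.of fun _ j => γv j) (Matrix.of fun i _ => γv i) Γ')
    (hpd : Γ.PosDef)
    (hM : ∀ i j, i ≠ j → Γ⁻¹ i j ≤ 0) :
    ∀ i, 0 ≤ (Γ'⁻¹ *ᵥ γv) i := by
  intro i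
  have hpd' : Γ'.PosDef := by
    have h := hpd.submatrix (e := (Sum.inr : Fin N → Unit ⊕ Fin N)) Sum.inr_injective
    have e : Γ.submatrix (Sum.inr : Fin N → Unit ⊕ Fin N) Sum.inr = Γ' := by
      subst hΓ
      ext a b
      simp
    rwa [e] at h
  have hu' : IsUnit Γ'.det := (Matrix.isUnit_iff_isUnit_det _).1 hpd'.isUnit
  have hu : IsUnit Γ.det := (Matrix.isUnit_iff_isUnit_det _).1 hpd.isUnit
  have ha : 0 < Γ⁻¹ (Sum.inl ()) (Sum.inl ()) := hpd.inv.diag_pos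
  have hb := hM (Sum.inr i) (Sum.inl ()) (by simp)
  have hmul := Matrix.mul_nonsing_inv Γ hu
  generalize Γ⁻¹ = G at *
  have hv : G (Sum.inl ()) (Sum.inl ()) • γv + Γ' *ᵥ (fun j => G (Sum.inr j) (Sum.inl ())) = 0 := by
    ext k
    have h := congrFun (congrFun hmul (Sum.inr k)) (Sum.inl ())
    subst hΓ
    simp [Matrix.mul_apply] at h
    simp [Matrix.mulVec, dotProduct]
    linarith
  have h2 := congrFun (congrArg (fun v => Γ'⁻¹ *ᵥ v) hv) i
  simp only [Matrix.mulVec_add, Matrix.mulVec_smul, Matrix.mulVec_mulVec,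
    Matrix.nonsing_inv_mul _ hu', Matrix.one_mulVec, Matrix.mulVec_zero, Pi.add_apply,
    Pi.smul_apply, smul_eq_mul, Pi.zero_apply] at h2
  have h3 : 0 ≤ G (Sum.inl ()) (Sum.inl ()) * (Γ'⁻¹ *ᵥ γv) i := by linarith
  exact nonneg_of_mul_nonneg_right h3 ha
end

section
/- Let Σ be an (m+n)×(m+n) symmetric inverse M-matrix (a real symmetric positive definite matrix whose inverse is a symmetric M-matrix), written in block form Σ = [[Σ₁₁, Σ₁₂],[Σ₂₁, Σ₂₂]] with Σ₁₁ of size m×m. Then every entry of the matrix Σ₂₁ Σ₁₁⁻¹ is nonnegative. -/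
open Matrix

lemma mmatrix_mono {n : ℕ} (P : Matrix (Fin n) (Fin n) ℝ) (hP : P.PosDef)
    (ho : ∀ i j, i ≠ j → P i j ≤ 0) (v : Fin n → ℝ) (hv : ∀ i, 0 ≤ (P *ᵥ v) i) :
    ∀ i, 0 ≤ v i := by
  set w : Fin n → ℝ := fun i => max (-v i) 0 with hw
  have hw0 : ∀ i, 0 ≤ w i := fun i => le_max_right _ _
  have key : w ⬝ᵥ (P *ᵥ w) + w ⬝ᵥ (P *ᵥ v) ≤ 0 := by
    rw [← dotProduct_add, ← mulVec_add]
    simp only [dotProduct, mulVec, Finset.mul_sum]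
    refine Finset.sum_nonpos fun i _ => Finset.sum_nonpos fun j _ => ?_
    have h2 : 0 ≤ (w + v) j := by
      have := le_max_left (-v j) 0
      simp only [Pi.add_apply, hw]; linarith
    by_cases hij : i = j
    · subst hij
      have : w i * (w + v) i = 0 := by
        simp only [Pi.add_apply, hw]
        rcases le_total (-v i) 0 with h | h
        · rw [max_eq_right h]; simp
        · rw [max_eq_left h]; ring
      have h3 : w i * (P i i * (w + v) i) = P i i * (w i * (w + v) i) := by ring
      rw [h3, this, mul_zero]
    · exact mul_nonpos_of_nonneg_of_nonpos (hw0 i)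
        (mul_nonpos_of_nonpos_of_nonneg (ho i j hij) h2)
  have h1 : 0 ≤ w ⬝ᵥ (P *ᵥ v) := Finset.sum_nonneg fun i _ => mul_nonneg (hw0 i) (hv i)
  have hz : w = 0 := by
    by_contra hne
    have := hP.dotProduct_mulVec_pos hne
    simp only [star_trivial] at this
    linarith
  intro i
  have h3 : w i = 0 := by rw [hz]; rfl
  have h4 := le_max_left (-v i) 0
  have h5 : max (-v i) 0 = 0 := h3
  linarith

/-- For a symmetric inverse M-matrix in block form, every entry of `Σ₂₁ Σ₁₁⁻¹` is
nonnegative. -/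
theorem block_mul_inv_block_nonneg
    {m n : ℕ}
    (A : Matrix (Fin m) (Fin m) ℝ) (B : Matrix (Fin m) (Fin n) ℝ)
    (C : Matrix (Fin n) (Fin m) ℝ) (D : Matrix (Fin n) (Fin n) ℝ)
    (hpd : (Matrix.fromBlocks A B C D).PosDef)
    (hM : ∀ i j, i ≠ j → (Matrix.fromBlocks A B C D)⁻¹ i j ≤ 0) :
    ∀ (i : Fin n) (j : Fin m), 0 ≤ (C * A⁻¹) i j := by
  have hA : A.PosDef := hpd.submatrix (e := Sum.inl) Sum.inl_injective
  have hAu : IsUnit A.det := (Matrix.isUnit_iff_isUnit_det _).1 hA.isUnit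
  have hK := hpd.inv
  have hmul := Matrix.nonsing_inv_mul _ ((Matrix.isUnit_iff_isUnit_det _).1 hpd.isUnit)
  generalize (Matrix.fromBlocks A B C D)⁻¹ = K at hM hK hmul
  have hP : K.toBlocks₂₂.PosDef := hK.submatrix (e := Sum.inr) Sum.inr_injective
  have h21 : K.toBlocks₂₁ * A + K.toBlocks₂₂ * C = 0 := by
    rw [← fromBlocks_toBlocks K, fromBlocks_multiply, ← fromBlocks_one] at hmul
    exact (fromBlocks_inj.1 hmul).2.2.1
  have h : K.toBlocks₂₂ * (C * A⁻¹) = -K.toBlocks₂₁ := by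
    rw [← Matrix.mul_assoc, eq_neg_of_add_eq_zero_right h21, Matrix.neg_mul, Matrix.mul_assoc,
      Matrix.mul_nonsing_inv _ hAu, Matrix.mul_one]
  intro i j
  refine mmatrix_mono K.toBlocks₂₂ hP (fun a b hab => hM _ _ (by simpa using hab))
    (fun k => (C * A⁻¹) k j) (fun k => ?_) i
  have h' : (K.toBlocks₂₂ *ᵥ fun k => (C * A⁻¹) k j) k = (K.toBlocks₂₂ * (C * A⁻¹)) k j := rfl
  rw [h', h]
  have := hM (Sum.inr k) (Sum.inl j) (by simp)
  simpa [toBlocks₂₁] using this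
end
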